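/- For every t > 0 and every x ∈ ℝⁿ \ {0}: if |x| ≤ ρ(t), then U(x,t) = A·t·|x|^{2−n} + (L/(2n))·|x|² − (1/2)·(A·n·t)^{2/n}·((n−2)/L)^{(2−n)/n}; and if |x| ≥ ρ(t), then U(x,t) = 0. -/

import Mathlib

open Real Filter MeasureTheory

/-- The integral over `[0, t]` of the positive part of `c ^ (2 - n) - (k s) ^ ((2 - n) / n)`, which
switches on at the time `s = c ^ n / k`. -/
theorem integral_of_switch_on {n k c t : ℝ} (hn : 2 < n) (hk : 0 < k) (hc : 0 < c)
    (ht : c ^ n / k ≤ t) {A : ℝ} {v : ℝ → ℝ} (hv₀ : ∀ s, 0 < s → s ≤ c ^ n / k → v s = 0)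
    (hv₁ : ∀ s, c ^ n / k ≤ s → v s = A * (c ^ (2 - n) - (k * s) ^ ((2 - n) / n))) :
    ∫ s in (0:ℝ)..t, v s =
      A * t * c ^ (2 - n) + A * (n - 2) / (2 * k) * c ^ 2
        - A * n / 2 * (k ^ ((2 - n) / n) * t ^ (2 / n)) := by
  have hn0 : 0 < n := by linarith
  set τ := c ^ n / k with hτ
  have hτ0 : 0 < τ := by positivity
  have ht0 : 0 < t := hτ0.trans_le ht
  have hp : (2 - n) / n + 1 = 2 / n := by field_simp; ring
  have hp' : -1 < (2 - n) / n := by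
    have : 0 < 2 / n := by positivity
    linarith
  have e₀ : Set.EqOn (fun _ => (0:ℝ)) v (Set.uIoc 0 τ) := by
    intro s hs
    rw [Set.uIoc_of_le hτ0.le] at hs
    exact (hv₀ s hs.1 hs.2).symm
  have e₁ : Set.EqOn (fun s => A * (c ^ (2 - n) - k ^ ((2 - n) / n) * s ^ ((2 - n) / n))) v
      (Set.uIoc τ t) := by
    intro s hs
    rw [Set.uIoc_of_le ht] at hs
    rw [hv₁ s hs.1.le, mul_rpow hk.le (hτ0.trans hs.1).le]
  have ip : IntervalIntegrable (fun s : ℝ => k ^ ((2 - n) / n) * s ^ ((2 - n) / n)) volume τ t :=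
    (intervalIntegral.intervalIntegrable_rpow' hp').const_mul _
  have i₀ : IntervalIntegrable v volume 0 τ := intervalIntegrable_const.congr e₀
  have i₁ : IntervalIntegrable v volume τ t :=
    ((intervalIntegrable_const.sub ip).const_mul A).congr e₁
  have h₀ : ∫ s in (0:ℝ)..τ, v s = 0 := by
    rw [← intervalIntegral.integral_congr_ae (.of_forall e₀), intervalIntegral.integral_zero]
  have h₁ : ∫ s in τ..t, v s = A * ((t - τ) * c ^ (2 - n)
      - k ^ ((2 - n) / n) * ((t ^ (2 / n) - τ ^ (2 / n)) / (2 / n))) := by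
    rw [← intervalIntegral.integral_congr_ae (.of_forall e₁), intervalIntegral.integral_const_mul,
      intervalIntegral.integral_sub intervalIntegrable_const ip,
      intervalIntegral.integral_const_mul, integral_rpow (Or.inl hp'), hp,
      intervalIntegral.integral_const, smul_eq_mul]
  have a₁ : τ * c ^ (2 - n) = c ^ 2 / k := by
    rw [hτ, div_mul_eq_mul_div, ← rpow_add hc, add_sub_cancel, rpow_two]
  have a₂ : k ^ ((2 - n) / n) * τ ^ (2 / n) = c ^ 2 / k := by
    rw [hτ, div_rpow (by positivity) hk.le, ← rpow_mul hc.le, mul_div_cancel₀ _ hn0.ne', rpow_two,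
      ← hp, rpow_add hk, rpow_one]
    have := (rpow_pos_of_pos hk ((2 - n) / n)).ne'
    field_simp
  rw [← intervalIntegral.integral_add_adjacent_intervals i₀ i₁, h₀, h₁]
  have : A * ((t - τ) * c ^ (2 - n)
      - k ^ ((2 - n) / n) * ((t ^ (2 / n) - τ ^ (2 / n)) / (2 / n))) =
      A * t * c ^ (2 - n) - A * (τ * c ^ (2 - n)) + A * n / 2 * (k ^ ((2 - n) / n) * τ ^ (2 / n))
        - A * n / 2 * (k ^ ((2 - n) / n) * t ^ (2 / n)) := by
    field_simp
    ring
  rw [zero_add, this, a₁, a₂]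
  field_simp
  ring

/-- Explicit formula for the Baiocchi transform `U(x,t) = ∫₀ᵗ V(x,s) ds` of the
self-similar point-source solution `V(x,t) = A(|x|^{2−n} − ρ(t)^{2−n})₊`,
`ρ(t) = (A n (n−2) t / L)^{1/n}`, in dimensions `n ≥ 3`. -/
theorem stmt_9 (n : ℕ) (hn : 3 ≤ n) (A L : ℝ) (hA : 0 < A) (hL : 0 < L)
    (ρ : ℝ → ℝ) (hρ : ∀ t : ℝ, 0 ≤ t → ρ t = (A * n * ((n : ℝ) - 2) * t / L) ^ ((1 : ℝ) / n))
    (V : EuclideanSpace ℝ (Fin n) → ℝ → ℝ)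
    (hV : ∀ x : EuclideanSpace ℝ (Fin n), x ≠ 0 → ∀ t : ℝ, 0 ≤ t →
      V x t = A * max (‖x‖ ^ ((2 : ℝ) - n) - (ρ t) ^ ((2 : ℝ) - n)) 0)
    (U : EuclideanSpace ℝ (Fin n) → ℝ → ℝ)
    (hU : ∀ x : EuclideanSpace ℝ (Fin n), ∀ t : ℝ, U x t = ∫ s in (0:ℝ)..t, V x s) :
    ∀ t : ℝ, 0 < t → ∀ x : EuclideanSpace ℝ (Fin n), x ≠ 0 →
      (‖x‖ ≤ ρ t →
        U x t = A * t * ‖x‖ ^ ((2 : ℝ) - n) + L / (2 * n) * ‖x‖ ^ 2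
          - (1 / 2) * (A * n * t) ^ ((2 : ℝ) / n) * (((n : ℝ) - 2) / L) ^ (((2 : ℝ) - n) / n)) ∧
      (ρ t ≤ ‖x‖ → U x t = 0) := by
  intro t ht x hx
  have hn2 : (2:ℝ) < n := by exact_mod_cast hn
  have hn0 : (0:ℝ) < n := by linarith
  have hd : (0:ℝ) < n - 2 := by linarith
  have hc : 0 < ‖x‖ := norm_pos_iff.2 hx
  set k : ℝ := A * n * ((n : ℝ) - 2) / L with hk_def
  have hk : 0 < k := by positivity
  have hρk (s : ℝ) (hs : 0 ≤ s) : ρ s = (k * s) ^ ((1 : ℝ) / n) := by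
    rw [hρ s hs, hk_def, div_mul_eq_mul_div]
  have hroot : (‖x‖ ^ (n : ℝ)) ^ ((1 : ℝ) / n) = ‖x‖ := by
    rw [← rpow_mul hc.le, mul_one_div_cancel hn0.ne', rpow_one]
  have hle (s : ℝ) (hs : 0 ≤ s) : ρ s ≤ ‖x‖ ↔ s ≤ ‖x‖ ^ (n : ℝ) / k := by
    rw [hρk s hs, le_div_iff₀' hk]
    nth_rewrite 1 [← hroot]
    exact rpow_le_rpow_iff (by positivity) (by positivity) (by positivity)
  have hge (s : ℝ) (hs : 0 ≤ s) : ‖x‖ ≤ ρ s ↔ ‖x‖ ^ (n : ℝ) / k ≤ s := by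
    rw [hρk s hs, div_le_iff₀' hk]
    nth_rewrite 1 [← hroot]
    exact rpow_le_rpow_iff (by positivity) (by positivity) (by positivity)
  have hv₀ (s : ℝ) (hs : 0 < s) (h : s ≤ ‖x‖ ^ (n : ℝ) / k) : V x s = 0 := by
    have hpos : 0 < ρ s := by rw [hρk s hs.le]; positivity
    have := rpow_le_rpow_of_nonpos hpos ((hle s hs.le).2 h) (by linarith : (2:ℝ) - n ≤ 0)
    rw [hV x hx s hs.le, max_eq_right (by linarith), mul_zero]
  have hv₁ (s : ℝ) (h : ‖x‖ ^ (n : ℝ) / k ≤ s) :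
      V x s = A * (‖x‖ ^ ((2:ℝ) - n) - (k * s) ^ (((2:ℝ) - n) / n)) := by
    have hs : 0 ≤ s := le_trans (by positivity) h
    have := rpow_le_rpow_of_nonpos hc ((hge s hs).2 h) (by linarith : (2:ℝ) - n ≤ 0)
    rw [hV x hx s hs, max_eq_left (by linarith), hρk s hs, ← rpow_mul (by positivity),
      one_div_mul_eq_div]
  constructor
  · intro h
    rw [hU, integral_of_switch_on hn2 hk hc ((hge t ht.le).1 h) hv₀ hv₁]
    have hcoef : A * ((n : ℝ) - 2) / (2 * k) = L / (2 * n) := by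
      rw [hk_def]
      field_simp
    have hconst : A * n * k ^ (((2:ℝ) - n) / n) =
        (A * n) ^ ((2:ℝ) / n) * (((n : ℝ) - 2) / L) ^ (((2:ℝ) - n) / n) := by
      have hp : (2:ℝ) / n = 1 + (2 - n) / n := by field_simp; ring
      rw [hk_def, mul_div_assoc, mul_rpow (by positivity) (by positivity), hp,
        rpow_add (by positivity), rpow_one]
      ring
    rw [hcoef, mul_rpow (by positivity : 0 ≤ A * n) ht.le]
    linear_combination (-(1 / 2) * t ^ ((2:ℝ) / n)) * hconst
  · intro h
    rw [hU, intervalIntegral.integral_of_le ht.le]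
    refine setIntegral_eq_zero_of_forall_eq_zero fun s hs => ?_
    exact hv₀ s hs.1 (hs.2.trans ((hle t ht.le).1 h))
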